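/- Symbolic feasibility of the sublinear-rate matrix inequality: For every L_h > 0 and every λ ∈ (0,2), set α = (2−λ)/L_h, σ₁ = σ₂ = σ₃ = 2λ/α = 2λL_h/(2−λ), and θ = (2−λ)³λ/(2L_h²). Then the 4×4 symmetric real matrix W₀ + σ₁Q₁ + σ₂Q₂ + σ₃Q₃ is negative semidefinite, where W₀ = [[λ²+θ/α², 0, −λ²−θ/α², −λ], [0,0,0,0], [−λ²−θ/α², 0, λ²+θ/α², λ], [−λ, 0, λ, 0]], Q₁ = B_gᵀ·[[0,1/2],[1/2,0]]·B_g with B_g = [[α,0,0,0],[−1,0,0,1]], Q₂ = B_hᵀ·[[0,1/2],[1/2,−1/L_h]]·B_h with B_h = [[α,0,0,0],[2,−1,0,−1]], and Q₃ = B_fᵀ·[[0,1/2],[1/2,0]]·B_f with B_f = [[0,0,α,0],[0,1,−1,0]]. -/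

import Mathlib

open Matrix

/-- The matrix `W₀` appearing in the sublinear-rate certificate. -/
noncomputable def W0mat (α lam θ : ℝ) : Matrix (Fin 4) (Fin 4) ℝ :=
  !![lam ^ 2 + θ / α ^ 2, 0, -lam ^ 2 - θ / α ^ 2, -lam;
     0, 0, 0, 0;
     -lam ^ 2 - θ / α ^ 2, 0, lam ^ 2 + θ / α ^ 2, lam;
     -lam, 0, lam, 0]

noncomputable def BgMat (α : ℝ) : Matrix (Fin 2) (Fin 4) ℝ := !![α, 0, 0, 0; -1, 0, 0, 1]

noncomputable def BhMat (α : ℝ) : Matrix (Fin 2) (Fin 4) ℝ := !![α, 0, 0, 0; 2, -1, 0, -1]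

noncomputable def BfMat (α : ℝ) : Matrix (Fin 2) (Fin 4) ℝ := !![0, 0, α, 0; 0, 1, -1, 0]

/-- `Q₁ = B_gᵀ · [[0,1/2],[1/2,0]] · B_g`. -/
noncomputable def Q1mat (α : ℝ) : Matrix (Fin 4) (Fin 4) ℝ :=
  (BgMat α)ᵀ * !![(0 : ℝ), 1 / 2; 1 / 2, 0] * BgMat α

/-- `Q₂ = B_hᵀ · [[0,1/2],[1/2,−1/L_h]] · B_h`. -/
noncomputable def Q2mat (α L_h : ℝ) : Matrix (Fin 4) (Fin 4) ℝ :=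
  (BhMat α)ᵀ * !![(0 : ℝ), 1 / 2; 1 / 2, -1 / L_h] * BhMat α

/-- `Q₃ = B_fᵀ · [[0,1/2],[1/2,0]] · B_f`. -/
noncomputable def Q3mat (α : ℝ) : Matrix (Fin 4) (Fin 4) ℝ :=
  (BfMat α)ᵀ * !![(0 : ℝ), 1 / 2; 1 / 2, 0] * BfMat α

/-- **Symbolic feasibility of the sublinear-rate matrix inequality.** For every `L_h > 0`
and `λ ∈ (0, 2)`, the choice `α = (2−λ)/L_h`, `σ₁ = σ₂ = σ₃ = 2λ/α`,
`θ = (2−λ)³λ/(2L_h²)` makes `W₀ + σ₁Q₁ + σ₂Q₂ + σ₃Q₃` negative semidefinite. -/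
theorem sublinear_certificate_symbolic_solution
    (L_h lam α σ₁ σ₂ σ₃ θ : ℝ)
    (hLh : 0 < L_h) (hlam : lam ∈ Set.Ioo (0 : ℝ) 2)
    (hα : α = (2 - lam) / L_h)
    (hσ₁ : σ₁ = 2 * lam / α) (hσ₂ : σ₂ = 2 * lam / α) (hσ₃ : σ₃ = 2 * lam / α)
    (hθ : θ = (2 - lam) ^ 3 * lam / (2 * L_h ^ 2)) :
    ∀ v : Fin 4 → ℝ,
      v ⬝ᵥ ((W0mat α lam θ + σ₁ • Q1mat α + σ₂ • Q2mat α L_h + σ₃ • Q3mat α) *ᵥ v) ≤ 0 := by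
  intro v
  obtain ⟨h0, h2⟩ := hlam
  have hlt : 0 < 2 - lam := sub_pos.mpr h2
  have hne : 2 - lam ≠ 0 := hlt.ne'
  have hL : L_h ≠ 0 := hLh.ne'
  have key : v ⬝ᵥ ((W0mat α lam θ + σ₁ • Q1mat α + σ₂ • Q2mat α L_h + σ₃ • Q3mat α) *ᵥ v)
      = -(lam * (2 - lam) / 2 *
          (v 0 - v 2 - 2 * (2 * v 0 - v 1 - v 3) / (2 - lam)) ^ 2) := by
    subst hσ₁ hσ₂ hσ₃ hθ hα
    simp [W0mat, Q1mat, Q2mat, Q3mat, BgMat, BhMat, BfMat, dotProduct, mulVec, Matrix.mul_apply,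
      Fin.sum_univ_succ]
    field_simp
    ring
  rw [key, neg_nonpos]
  positivity
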